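/- arXiv:math/0603085 — 2 statements merged into one kernel-verified Lean document; each statement's English description precedes it below -/
import Mathlib

section
/- Let T > 0 and let V : [0,T] × ℝ³ → ℝ be a smooth function such that sup over all (t₀, x₀) ∈ [0,T] × ℝ³ of √2 ∫_{B(0, T−t₀)} |V(t₀+|y|, x₀+y)| / |y| dy ≤ 1/2. Let F ∈ C_c^∞((0,T) × ℝ³). Then there exists a smooth function φ : [0,T] × ℝ³ → ℝ, compactly supported in the space variable, such that ∂_t²φ − Δφ + Vφ = F on [0,T] × ℝ³, φ(T, ·) = 0, ∂_t φ(T, ·) = 0, and ‖φ‖_{L^∞([0,T]×ℝ³)} ≤ 2 · sup_{(t₀,x₀)} √2 ∫_{B(0,T−t₀)} |F(t₀+|y|, x₀+y)| / |y| dy. -/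
open MeasureTheory Metric Set
open scoped ENNReal

noncomputable section

/-- Physical space `ℝ³`. -/
abbrev E3 : Type := EuclideanSpace ℝ (Fin 3)

/-- Spatial divergence of a vector field on `ℝ³`. -/
def div3 (F : E3 → E3) (x : E3) : ℝ :=
  ∑ i : Fin 3, fderiv ℝ F x (EuclideanSpace.single i 1) i

/-- Spatial Laplacian of a scalar function on `ℝ³`. -/
def lap3 (f : E3 → ℝ) (x : E3) : ℝ := div3 (gradient f) x

open Filter Topology ContDiff

/-- The integral of `g` over the forward light cone with vertex `z`, weighted by `k`. -/
def coneInt {G : Type} [NormedAddCommGroup G] [NormedSpace ℝ G] (k : E3 → ℝ) (g : ℝ × E3 → G)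
    (z : ℝ × E3) : G :=
  ∫ y, k y • g (z + (‖y‖, y))

lemma continuous_comp_cone {G : Type} [TopologicalSpace G] {g : ℝ × E3 → G} (hg : Continuous g)
    (z : ℝ × E3) : Continuous fun y : E3 => g (z + (‖y‖, y)) := by
  fun_prop

lemma integrable_cone {G : Type} [NormedAddCommGroup G] [NormedSpace ℝ G] {k : E3 → ℝ}
    (hk : Integrable k) {g : ℝ × E3 → G} (hg : Continuous g) {C : ℝ} (hC : ∀ z, ‖g z‖ ≤ C)
    (z : ℝ × E3) : Integrable fun y => k y • g (z + (‖y‖, y)) :=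
  hk.smul_bdd C (continuous_comp_cone hg z).aestronglyMeasurable
    (Eventually.of_forall fun _ => hC _)

lemma norm_coneInt_le {G : Type} [NormedAddCommGroup G] [NormedSpace ℝ G] {k : E3 → ℝ}
    (hk : Integrable k) {g : ℝ × E3 → G} {C : ℝ} (hC : ∀ z, ‖g z‖ ≤ C) (z : ℝ × E3) :
    ‖coneInt k g z‖ ≤ (∫ y, |k y|) * C := by
  rw [← integral_mul_const]
  refine norm_integral_le_of_norm_le (hk.abs.mul_const C) (Eventually.of_forall fun y => ?_)
  rw [norm_smul, Real.norm_eq_abs]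
  exact mul_le_mul_of_nonneg_left (hC _) (abs_nonneg _)

lemma hasFDerivAt_coneInt {G : Type} [NormedAddCommGroup G] [NormedSpace ℝ G] {k : E3 → ℝ}
    (hk : Integrable k) {g : ℝ × E3 → G} (hg : ContDiff ℝ 1 g) {C C' : ℝ}
    (hC : ∀ z, ‖g z‖ ≤ C) (hC' : ∀ z, ‖fderiv ℝ g z‖ ≤ C') (z : ℝ × E3) :
    HasFDerivAt (coneInt k g) (coneInt k (fderiv ℝ g) z) z := by
  have hg' : Continuous (fderiv ℝ g) := hg.continuous_fderiv one_ne_zero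
  refine hasFDerivAt_integral_of_dominated_of_fderiv_le
    (F' := fun z y => k y • fderiv ℝ g (z + (‖y‖, y))) (bound := fun y => |k y| * C')
    univ_mem (Eventually.of_forall fun z => (integrable_cone hk hg.continuous hC z).1)
    (integrable_cone hk hg.continuous hC z) (integrable_cone hk hg' hC' z).1
    (Eventually.of_forall fun y w _ => ?_) (hk.abs.mul_const C')
    (Eventually.of_forall fun y w _ => ?_)
  · rw [norm_smul, Real.norm_eq_abs]
    exact mul_le_mul_of_nonneg_left (hC' _) (abs_nonneg _)
  · have h := (hg.differentiable one_ne_zero (w + (‖y‖, y))).hasFDerivAt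
    have h2 : HasFDerivAt (fun w : ℝ × E3 => w + (‖y‖, y)) (.id ℝ _) w :=
      (hasFDerivAt_id w).add_const _
    exact (h.comp w h2).const_smul (k y)

lemma contDiff_coneInt_and_bound {k : E3 → ℝ} (hk : Integrable k) (n : ℕ) :
    ∀ {G : Type} [NormedAddCommGroup G] [NormedSpace ℝ G] {g : ℝ × E3 → G} {C : ℕ → ℝ},
      ContDiff ℝ n g → (∀ m ≤ n, ∀ z, ‖iteratedFDeriv ℝ m g z‖ ≤ C m) →
      ContDiff ℝ n (coneInt k g) ∧
        ∀ z, ‖iteratedFDeriv ℝ n (coneInt k g) z‖ ≤ (∫ y, |k y|) * C n := by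
  induction n with
  | zero =>
    intro G _ _ g C hg hC
    have hC0 : ∀ z, ‖g z‖ ≤ C 0 := fun z => by simpa using hC 0 le_rfl z
    have hgc : Continuous g := hg.continuous
    refine ⟨?_, fun z => ?_⟩
    · rw [Nat.cast_zero, contDiff_zero]
      refine continuous_of_dominated (fun z => (integrable_cone hk hgc hC0 z).1)
        (bound := fun y => |k y| * C 0) (fun z => Eventually.of_forall fun y => ?_)
        (hk.abs.mul_const _) (Eventually.of_forall fun y => by fun_prop)
      rw [norm_smul, Real.norm_eq_abs]
      exact mul_le_mul_of_nonneg_left (hC0 _) (abs_nonneg _)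
    · rw [norm_iteratedFDeriv_zero]
      exact norm_coneInt_le hk hC0 z
  | succ n ih =>
    intro G _ _ g C hg hC
    have hC0 : ∀ z, ‖g z‖ ≤ C 0 := fun z => by simpa using hC 0 (Nat.zero_le _) z
    have hC1 : ∀ z, ‖fderiv ℝ g z‖ ≤ C 1 := fun z => by
      rw [← norm_iteratedFDeriv_one]; exact hC 1 (by omega) z
    have hg1 : ContDiff ℝ 1 g := hg.of_le (by exact_mod_cast Nat.le_add_left 1 n)
    have hder : ∀ z, HasFDerivAt (coneInt k g) (coneInt k (fderiv ℝ g) z) z :=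
      hasFDerivAt_coneInt hk hg1 hC0 hC1
    have hfd : fderiv ℝ (coneInt k g) = coneInt k (fderiv ℝ g) := funext fun z => (hder z).fderiv
    obtain ⟨h1, h2⟩ := ih (g := fderiv ℝ g) (C := fun m => C (m + 1))
      (hg.fderiv_right (by simp)) (fun m hm z => by
        rw [norm_iteratedFDeriv_fderiv]; exact hC (m + 1) (by omega) z)
    refine ⟨?_, fun z => ?_⟩
    · rw [Nat.cast_add, Nat.cast_one, contDiff_succ_iff_fderiv]
      exact ⟨fun z => (hder z).differentiableAt, fun h => by simp at h, hfd ▸ h1⟩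
    · rw [← norm_iteratedFDeriv_fderiv, hfd]
      exact h2 z

/-- Smooth functions all of whose derivatives are bounded. -/
def BddSmooth (g : ℝ × E3 → ℝ) : Prop :=
  ContDiff ℝ ∞ g ∧ ∀ n : ℕ, ∃ C : ℝ, ∀ z, ‖iteratedFDeriv ℝ n g z‖ ≤ C

lemma BddSmooth.of_hasCompactSupport {g : ℝ × E3 → ℝ} (hg : ContDiff ℝ ∞ g)
    (hs : HasCompactSupport g) : BddSmooth g :=
  ⟨hg, fun n => (hs.iteratedFDeriv n).exists_bound_of_continuous
    (hg.continuous_iteratedFDeriv (by exact_mod_cast le_top))⟩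

lemma contDiff_coneInt {k : E3 → ℝ} (hk : Integrable k) {g : ℝ × E3 → ℝ} (hg : ContDiff ℝ ∞ g)
    {C : ℕ → ℝ} (hC : ∀ n z, ‖iteratedFDeriv ℝ n g z‖ ≤ C n) :
    ContDiff ℝ ∞ (coneInt k g) ∧
      ∀ n z, ‖iteratedFDeriv ℝ n (coneInt k g) z‖ ≤ (∫ y, |k y|) * C n := by
  have h n := contDiff_coneInt_and_bound hk n (hg.of_le (by exact_mod_cast le_top))
    fun m _ => hC m
  exact ⟨contDiff_infty.2 fun n => (h n).1, fun n => (h n).2⟩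

lemma summable_of_le_half_add {a b : ℕ → ℝ} (ha : ∀ n, 0 ≤ a n) (hb : ∀ n, 0 ≤ b n)
    (hbs : Summable b) (h : ∀ n, a (n + 1) ≤ 1 / 2 * a n + b n) : Summable a := by
  refine summable_of_sum_range_le (c := 2 * (a 0 + ∑' n, b n)) ha fun n => ?_
  have h1 : ∑ i ∈ Finset.range (n + 1), a i ≤
      a 0 + (1 / 2 * ∑ i ∈ Finset.range n, a i + ∑ i ∈ Finset.range n, b i) := by
    rw [Finset.sum_range_succ', add_comm, Finset.mul_sum, ← Finset.sum_add_distrib]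
    gcongr with i
    exact h i
  rw [Finset.sum_range_succ] at h1
  have h2 := hbs.sum_le_tsum (Finset.range n) fun i _ => hb i
  linarith [ha n]

/-- Bounds for the derivatives of the Picard iterates. -/
def picardBound (m : ℝ) (w H : ℕ → ℝ) : ℕ → ℕ → ℝ
  | 0, j => m * H j
  | n + 1, j => m * ∑ i ∈ Finset.range (j + 1), (j.choose i : ℝ) * w i *
      picardBound m w H n (j - i)

lemma picardBound_nonneg {m : ℝ} {w H : ℕ → ℝ} (hm : 0 ≤ m) (hw : ∀ n, 0 ≤ w n)
    (hH : ∀ n, 0 ≤ H n) (n j : ℕ) : 0 ≤ picardBound m w H n j := by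
  induction n generalizing j with
  | zero => exact mul_nonneg hm (hH j)
  | succ n ih =>
    exact mul_nonneg hm (Finset.sum_nonneg fun i _ =>
      mul_nonneg (mul_nonneg (Nat.cast_nonneg _) (hw i)) (ih _))

lemma summable_picardBound {m : ℝ} {w H : ℕ → ℝ} (hm : 0 ≤ m) (hw : ∀ n, 0 ≤ w n)
    (hH : ∀ n, 0 ≤ H n) (hs : m * w 0 ≤ 1 / 2) (j : ℕ) :
    Summable fun n => picardBound m w H n j := by
  induction j using Nat.strong_induction_on with
  | _ j ih =>
  have h0 := picardBound_nonneg hm hw hH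
  refine summable_of_le_half_add (b := fun n => m * ∑ i ∈ Finset.range j,
    (j.choose (i + 1) : ℝ) * w (i + 1) * picardBound m w H n (j - (i + 1)))
    (fun n => h0 n j) (fun n => ?_) ?_ fun n => ?_
  · exact mul_nonneg hm (Finset.sum_nonneg fun i _ =>
      mul_nonneg (mul_nonneg (Nat.cast_nonneg _) (hw _)) (h0 _ _))
  · refine (summable_sum fun i hi => ?_).mul_left m
    rw [Finset.mem_range] at hi
    exact (ih (j - (i + 1)) (by omega)).mul_left _
  · rw [picardBound, Finset.sum_range_succ', mul_add, add_comm]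
    simp only [Nat.choose_zero_right, Nat.cast_one, one_mul, Nat.sub_zero]
    have := mul_le_mul_of_nonneg_right hs (h0 n j)
    linarith

/-- Picard iterates for the equation `ψ = K h + K (W ψ)`, where `K` is the cone integral. -/
def picardIter (k : E3 → ℝ) (W h : ℝ × E3 → ℝ) : ℕ → ℝ × E3 → ℝ
  | 0 => coneInt k h
  | n + 1 => coneInt k fun z => W z * picardIter k W h n z

lemma picardIter_bound {k : E3 → ℝ} (hk : Integrable k) {W h : ℝ × E3 → ℝ}
    (hW : ContDiff ℝ ∞ W) (hh : ContDiff ℝ ∞ h) {w H : ℕ → ℝ}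
    (hw : ∀ n z, ‖iteratedFDeriv ℝ n W z‖ ≤ w n) (hH : ∀ n z, ‖iteratedFDeriv ℝ n h z‖ ≤ H n)
    (n : ℕ) : ContDiff ℝ ∞ (picardIter k W h n) ∧ ∀ j z,
      ‖iteratedFDeriv ℝ j (picardIter k W h n) z‖ ≤ picardBound (∫ y, |k y|) w H n j := by
  have hw0 : ∀ n, 0 ≤ w n := fun n => (norm_nonneg _).trans (hw n 0)
  induction n with
  | zero => exact contDiff_coneInt hk hh hH
  | succ n ih =>
    refine contDiff_coneInt hk (hW.mul ih.1) fun j z => ?_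
    refine (norm_iteratedFDeriv_mul_le hW ih.1 z (by exact_mod_cast le_top)).trans ?_
    refine Finset.sum_le_sum fun i _ => ?_
    have := ih.2 (j - i) z
    have := hw i z
    have := hw0 i
    gcongr

/-- Solvability of `ψ = K h + K (W ψ)` in smooth functions. -/
lemma exists_smooth_fixedPoint {k : E3 → ℝ} (hk : Integrable k) {W h : ℝ × E3 → ℝ}
    (hW : ContDiff ℝ ∞ W) (hh : BddSmooth h) {w : ℕ → ℝ}
    (hw : ∀ n z, ‖iteratedFDeriv ℝ n W z‖ ≤ w n) (hs : (∫ y, |k y|) * w 0 ≤ 1 / 2) :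
    ∃ ψ : ℝ × E3 → ℝ, ContDiff ℝ ∞ ψ ∧ (∃ C, ∀ z, ‖ψ z‖ ≤ C) ∧
      (∀ z, ψ z = coneInt k h z + coneInt k (fun z => W z * ψ z) z) ∧
      ∀ S : Set (ℝ × E3), (∀ z y, z + (‖y‖, y) ∈ S → z ∈ S) → (∀ z ∉ S, h z = 0) →
        ∀ z ∉ S, ψ z = 0 := by
  obtain ⟨hhs, hH⟩ := hh
  choose H hH using hH
  have hw0 : ∀ n, 0 ≤ w n := fun n => (norm_nonneg _).trans (hw n 0)
  have hH0 : ∀ n, 0 ≤ H n := fun n => (norm_nonneg _).trans (hH n 0)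
  have hm : 0 ≤ ∫ y, |k y| := integral_nonneg fun y => abs_nonneg _
  have hsum := summable_picardBound hm hw0 hH0 hs
  have hb := picardIter_bound hk hW hhs hw hH
  set u := picardIter k W h with hu
  set v := picardBound (∫ y, |k y|) w H
  have hb0 : ∀ n z, ‖u n z‖ ≤ v n 0 := fun n z => by simpa using (hb n).2 0 z
  have hus : ∀ z, Summable fun n => u n z := fun z => .of_norm_bounded (hsum 0) (hb0 · z)
  have hWb : ∀ z, ‖W z‖ ≤ w 0 := fun z => by simpa using hw 0 z
  have hWu : ∀ n z, ‖W z * u n z‖ ≤ w 0 * v n 0 := fun n z => by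
    rw [norm_mul]
    exact mul_le_mul (hWb z) (hb0 n z) (norm_nonneg _) (hw0 0)
  refine ⟨fun z => ∑' n, u n z, ?_, ⟨∑' n, v n 0, fun z => ?_⟩, fun z => ?_, ?_⟩
  · exact contDiff_tsum (v := fun j n => v n j) (fun n => (hb n).1) (fun j _ => hsum j)
      fun j n z _ => (hb n).2 j z
  · exact tsum_of_norm_bounded (hsum 0).hasSum (hb0 · z)
  · beta_reduce
    rw [(hus z).tsum_eq_zero_add]
    congr 1
    have h1 : ∀ n, Integrable fun y => k y • (W (z + (‖y‖, y)) * u n (z + (‖y‖, y))) := fun n =>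
      integrable_cone (g := fun z => W z * u n z) hk
        (hW.continuous.mul (hb n).1.continuous) (hWu n) z
    have h2 := hasSum_integral_of_summable_integral_norm h1 (by
      refine Summable.of_nonneg_of_le (fun n => integral_nonneg fun y => norm_nonneg _)
        (fun n => ?_) (((hsum 0).mul_left (w 0)).mul_left (∫ y, |k y|))
      rw [← integral_mul_const]
      refine integral_mono (h1 n).norm (hk.abs.mul_const _) fun y => ?_
      simp only [norm_smul, Real.norm_eq_abs]
      exact mul_le_mul_of_nonneg_left (hWu n _) (abs_nonneg _))
    rw [show (∑' n, u (n + 1) z) = _ from h2.tsum_eq]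
    unfold coneInt
    congr 1 with y
    simp_rw [smul_eq_mul, tsum_mul_left]
  · intro S hS hhS z hz
    have : ∀ n, ∀ z ∉ S, u n z = 0 := by
      intro n
      induction n with
      | zero =>
        intro z hz
        refine integral_eq_zero_of_ae (Eventually.of_forall fun y => ?_)
        simp [hhS _ fun h => hz (hS z y h)]
      | succ n ih =>
        intro z hz
        refine integral_eq_zero_of_ae (Eventually.of_forall fun y => ?_)
        have := ih _ fun h => hz (hS z y h)
        simp only [hu] at this
        simp [this]
    simp [this _ z hz]

/-- The regularized norm `√(|y|² + ε²)`. -/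
def regNorm (ε : ℝ) (y : E3) : ℝ := √(‖y‖ ^ 2 + ε ^ 2)

lemma regNorm_pos {ε : ℝ} (hε : 0 < ε) (y : E3) : 0 < regNorm ε y :=
  Real.sqrt_pos.2 (by positivity)

lemma regNorm_sq (ε : ℝ) (y : E3) : regNorm ε y ^ 2 = ‖y‖ ^ 2 + ε ^ 2 :=
  Real.sq_sqrt (by positivity)

lemma norm_le_regNorm (ε : ℝ) (y : E3) : ‖y‖ ≤ regNorm ε y :=
  Real.le_sqrt_of_sq_le (by nlinarith [sq_nonneg ε])

lemma le_regNorm (ε : ℝ) (y : E3) : ε ≤ regNorm ε y :=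
  Real.le_sqrt_of_sq_le (by nlinarith [sq_nonneg ‖y‖])

lemma continuous_regNorm (ε : ℝ) : Continuous (regNorm ε) := by
  unfold regNorm; fun_prop

/-- The `i`-th spatial coordinate direction. -/
abbrev ee (i : Fin 3) : E3 := EuclideanSpace.single i 1

lemma hasDerivAt_regNorm {ε : ℝ} (hε : 0 < ε) (y : E3) (i : Fin 3) :
    HasDerivAt (fun s : ℝ => regNorm ε (y + s • ee i)) (y i / regNorm ε y) 0 := by
  have h1 : HasDerivAt (fun s : ℝ => y + s • ee i) (ee i) 0 := by
    simpa using ((hasDerivAt_id (0 : ℝ)).smul_const (ee i)).const_add y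
  have h2 := (h1.norm_sq.add_const (ε ^ 2)).sqrt (by simp; positivity)
  refine h2.congr_deriv ?_
  simp [regNorm, EuclideanSpace.inner_single_right]
  field_simp

/-- Second derivative of `g` at `z`, in directions `u` and `v`. -/
def sndDeriv (g : ℝ × E3 → ℝ) (u v : ℝ × E3) (z : ℝ × E3) : ℝ := fderiv ℝ (fderiv ℝ g) z u v

/-- The d'Alembert operator `∂ₜ² - Δ`. -/
def box (g : ℝ × E3 → ℝ) (z : ℝ × E3) : ℝ :=
  sndDeriv g (1, 0) (1, 0) z - ∑ i, sndDeriv g (0, ee i) (0, ee i) z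

/-- Component of the vector field whose divergence is, up to lower order errors in `ε`, equal to
`box g / r` on the regularized cone. -/
def flux (g : ℝ × E3 → ℝ) (ε : ℝ) (i : Fin 3) (y : E3) : ℝ :=
  fderiv ℝ g (regNorm ε y, y) (1, 0) * y i / regNorm ε y ^ 2
    - fderiv ℝ g (regNorm ε y, y) (0, ee i) / regNorm ε y
    - g (regNorm ε y, y) * y i / regNorm ε y ^ 3

/-- The derivative of `flux g ε i` in the direction `i`. -/
def fluxDeriv (g : ℝ × E3 → ℝ) (ε : ℝ) (i : Fin 3) (y : E3) : ℝ :=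
  let r := regNorm ε y
  let z : ℝ × E3 := (r, y)
  (y i / r * sndDeriv g (1, 0) (1, 0) z + sndDeriv g (1, 0) (0, ee i) z) * (y i / r ^ 2)
    + fderiv ℝ g z (1, 0) * (1 / r ^ 2 - 2 * y i ^ 2 / r ^ 4)
    - (y i / r * sndDeriv g (1, 0) (0, ee i) z + sndDeriv g (0, ee i) (0, ee i) z) / r
    + fderiv ℝ g z (0, ee i) * (y i / r ^ 3)
    - (y i / r * fderiv ℝ g z (1, 0) + fderiv ℝ g z (0, ee i)) * (y i / r ^ 3)
    - g z * (1 / r ^ 3 - 3 * y i ^ 2 / r ^ 5)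

lemma hasLineDerivAt_flux {g : ℝ × E3 → ℝ} (hg : ContDiff ℝ ∞ g) {ε : ℝ} (hε : 0 < ε) (i : Fin 3)
    (y : E3) : HasLineDerivAt ℝ (flux g ε i) (fluxDeriv g ε i y) y (ee i) := by
  have hr := hasDerivAt_regNorm hε y i
  have hr0 : regNorm ε (y + (0 : ℝ) • ee i) ≠ 0 := (regNorm_pos hε _).ne'
  have hr0' : regNorm ε y ≠ 0 := (regNorm_pos hε _).ne'
  have hl : HasDerivAt (fun s : ℝ => y + s • ee i) (ee i) 0 := by
    simpa using ((hasDerivAt_id (0 : ℝ)).smul_const (ee i)).const_add y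
  have hy : HasDerivAt (fun s : ℝ => (y + s • ee i) i) 1 0 := by
    simpa using ((hasDerivAt_id (0 : ℝ))).const_add (y i)
  have hγ := hr.prodMk hl
  have hg1 : ContDiff ℝ ∞ (fderiv ℝ g) := hg.fderiv_right (by simp)
  have hsplit : ((y i / regNorm ε y, ee i) : ℝ × E3) =
      (y i / regNorm ε y) • ((1, 0) : ℝ × E3) + (0, ee i) := by simp
  have hG := ((hg.differentiable (by simp)) (regNorm ε (y + (0 : ℝ) • ee i), y + (0 : ℝ) • ee i)
    ).hasFDerivAt.comp_hasDerivAt _ hγ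
  have hD := ((hg1.differentiable (by simp))
    (regNorm ε (y + (0 : ℝ) • ee i), y + (0 : ℝ) • ee i)).hasFDerivAt.comp_hasDerivAt _ hγ
  have hP := hD.clm_apply (hasDerivAt_const (0 : ℝ) ((1, 0) : ℝ × E3))
  have hQ := hD.clm_apply (hasDerivAt_const (0 : ℝ) ((0, ee i) : ℝ × E3))
  have hsymm : fderiv ℝ (fderiv ℝ g) (regNorm ε y, y) (0, ee i) (1, 0) =
      fderiv ℝ (fderiv ℝ g) (regNorm ε y, y) (1, 0) (0, ee i) :=
    (hg.contDiffAt.isSymmSndFDerivAt (by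
      simpa using WithTop.coe_le_coe.2 (le_top : (2 : ℕ∞) ≤ ⊤))) _ _
  have := (((hP.mul hy).div (hr.pow 2) (pow_ne_zero 2 hr0)).sub (hQ.div hr hr0)).sub
    ((hG.mul hy).div (hr.pow 3) (pow_ne_zero 3 hr0))
  refine this.congr_deriv ?_
  simp only [zero_smul, add_zero, map_zero, Function.comp_apply, hsplit, map_add, map_smul,
    add_apply, smul_apply, Pi.mul_apply, Pi.pow_apply, smul_eq_mul, hsymm,
    fluxDeriv, sndDeriv]
  generalize fderiv ℝ (fderiv ℝ g) (regNorm ε y, y) = D2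
  generalize fderiv ℝ g (regNorm ε y, y) = D1
  generalize regNorm ε y = r at *
  push_cast
  simp
  field_simp
  ring

lemma sum_fluxDeriv (g : ℝ × E3 → ℝ) {ε : ℝ} (hε : 0 < ε) (y : E3) :
    ∑ i, fluxDeriv g ε i y = (box g (regNorm ε y, y) / regNorm ε y
      - ε ^ 2 / regNorm ε y ^ 3 * sndDeriv g (1, 0) (1, 0) (regNorm ε y, y)
      + 3 * ε ^ 2 / regNorm ε y ^ 4 * fderiv ℝ g (regNorm ε y, y) (1, 0))
      - 3 * ε ^ 2 / regNorm ε y ^ 5 * g (regNorm ε y, y) := by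
  have hr0 : regNorm ε y ≠ 0 := (regNorm_pos hε _).ne'
  have h : ε ^ 2 = regNorm ε y ^ 2 - (y 0 ^ 2 + y 1 ^ 2 + y 2 ^ 2) := by
    rw [regNorm_sq, EuclideanSpace.norm_sq_eq, Fin.sum_univ_three]
    simp
  rw [h]
  simp only [fluxDeriv, box, Fin.sum_univ_three]
  generalize regNorm ε y = r at *
  field_simp
  ring

lemma integral_eq_zero_of_hasLineDerivAt {A A' : E3 → ℝ} {v : E3}
    (hA : ∀ y, HasLineDerivAt ℝ A (A' y) y v) (hAi : Integrable A) (hAi' : Integrable A') :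
    ∫ y, A' y = 0 := by
  have := integral_bilinear_hasLineDerivAt_right_eq_neg_left_of_integrable (μ := volume)
    (f := fun _ : E3 => (1 : ℝ)) (f' := fun _ => 0) (g := A) (g' := A') (v := v)
    (B := ContinuousLinearMap.mul ℝ ℝ) (by simp) (by simpa using hAi') (by simpa using hAi)
    (fun x _ => by simpa [HasLineDerivAt] using hasDerivAt_const (0 : ℝ) (1 : ℝ)) (fun x _ => hA x)
  simpa using this

lemma exists_radius {g : ℝ × E3 → ℝ} (hs : HasCompactSupport g) :
    ∃ R : ℝ, 0 < R ∧ ∀ z : ℝ × E3, R ≤ ‖z.2‖ →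
      g z = 0 ∧ fderiv ℝ g z = 0 ∧ fderiv ℝ (fderiv ℝ g) z = 0 := by
  obtain ⟨R, hR, h⟩ := hs.isCompact.isBounded.subset_ball_lt 0 0
  refine ⟨R, hR, fun z hz => ?_⟩
  have h1 : z ∉ tsupport g := fun h' => by
    have := h h'
    rw [mem_ball_zero_iff] at this
    linarith [norm_snd_le z]
  have h2 : z ∉ tsupport (fderiv ℝ g) := fun h' => h1 (tsupport_fderiv_subset ℝ h')
  have h3 : z ∉ tsupport (fderiv ℝ (fderiv ℝ g)) := fun h' => h2 (tsupport_fderiv_subset ℝ h')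
  exact ⟨image_eq_zero_of_notMem_tsupport h1, image_eq_zero_of_notMem_tsupport h2,
    image_eq_zero_of_notMem_tsupport h3⟩

lemma continuous_sndDeriv {g : ℝ × E3 → ℝ} (hg : ContDiff ℝ ∞ g) (u v : ℝ × E3) :
    Continuous (sndDeriv g u v) := by
  have hg1 : ContDiff ℝ ∞ (fderiv ℝ g) := hg.fderiv_right (by simp)
  have := hg1.continuous_fderiv (by simp)
  unfold sndDeriv
  fun_prop

lemma continuous_box {g : ℝ × E3 → ℝ} (hg : ContDiff ℝ ∞ g) : Continuous (box g) :=
  (continuous_sndDeriv hg _ _).sub (continuous_finsetSum _ fun _ _ => continuous_sndDeriv hg _ _)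

lemma integral_regularized {g : ℝ × E3 → ℝ} (hg : ContDiff ℝ ∞ g) (hs : HasCompactSupport g)
    {ε : ℝ} (hε : 0 < ε) :
    ∫ y, (box g (regNorm ε y, y) / regNorm ε y
      - ε ^ 2 / regNorm ε y ^ 3 * sndDeriv g (1, 0) (1, 0) (regNorm ε y, y)
      + 3 * ε ^ 2 / regNorm ε y ^ 4 * fderiv ℝ g (regNorm ε y, y) (1, 0)) =
    ∫ y, 3 * ε ^ 2 / regNorm ε y ^ 5 * g (regNorm ε y, y) := by
  obtain ⟨R, hR, hz⟩ := exists_radius hs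
  have hr0 : ∀ y, regNorm ε y ≠ 0 := fun y => (regNorm_pos hε y).ne'
  have hrc : Continuous (regNorm ε) := continuous_regNorm ε
  have hgc : Continuous g := hg.continuous
  have hDc : Continuous (fderiv ℝ g) := hg.continuous_fderiv (by simp)
  have hSc := continuous_sndDeriv hg
  have hbc := continuous_box hg
  have key : ∀ f : E3 → ℝ, Continuous f → (∀ y, R < ‖y‖ → f y = 0) → Integrable f :=
    fun f hf h => hf.integrable_of_hasCompactSupport
      (HasCompactSupport.intro (isCompact_closedBall 0 R) fun y hy => h y (by simpa using hy))
  have hflux : ∀ i, Integrable (flux g ε i) := fun i => by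
    refine key _ ?_ fun y hy => ?_
    · unfold flux
      have : ∀ y, regNorm ε y ^ 2 ≠ 0 := fun y => pow_ne_zero _ (hr0 y)
      have : ∀ y, regNorm ε y ^ 3 ≠ 0 := fun y => pow_ne_zero _ (hr0 y)
      fun_prop (disch := assumption)
    · obtain ⟨h1, h2, h3⟩ := hz (regNorm ε y, y) hy.le
      simp [flux, h1, h2]
  have hfluxD : ∀ i, Integrable (fluxDeriv g ε i) := fun i => by
    refine key _ ?_ fun y hy => ?_
    · unfold fluxDeriv
      have : ∀ y, regNorm ε y ^ 2 ≠ 0 := fun y => pow_ne_zero _ (hr0 y)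
      have : ∀ y, regNorm ε y ^ 3 ≠ 0 := fun y => pow_ne_zero _ (hr0 y)
      have : ∀ y, regNorm ε y ^ 4 ≠ 0 := fun y => pow_ne_zero _ (hr0 y)
      have : ∀ y, regNorm ε y ^ 5 ≠ 0 := fun y => pow_ne_zero _ (hr0 y)
      dsimp only
      fun_prop (disch := assumption)
    · obtain ⟨h1, h2, h3⟩ := hz (regNorm ε y, y) hy.le
      simp [fluxDeriv, sndDeriv, h1, h2, h3]
  have h0 : ∫ y, ∑ i, fluxDeriv g ε i y = 0 := by
    rw [integral_finsetSum _ fun i _ => hfluxD i]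
    exact Finset.sum_eq_zero fun i _ =>
      integral_eq_zero_of_hasLineDerivAt (hasLineDerivAt_flux hg hε i) (hflux i) (hfluxD i)
  simp_rw [sum_fluxDeriv g hε] at h0
  rwa [integral_sub, sub_eq_zero] at h0
  · refine key _ ?_ fun y hy => ?_
    · have : ∀ y, regNorm ε y ^ 3 ≠ 0 := fun y => pow_ne_zero _ (hr0 y)
      have : ∀ y, regNorm ε y ^ 4 ≠ 0 := fun y => pow_ne_zero _ (hr0 y)
      fun_prop (disch := assumption)
    · obtain ⟨h1, h2, h3⟩ := hz (regNorm ε y, y) hy.le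
      simp [box, sndDeriv, h2, h3]
  · refine key _ ?_ fun y hy => ?_
    · have : ∀ y, regNorm ε y ^ 5 ≠ 0 := fun y => pow_ne_zero _ (hr0 y)
      fun_prop (disch := assumption)
    · obtain ⟨h1, h2, h3⟩ := hz (regNorm ε y, y) hy.le
      simp [h1]

lemma hasDerivAt_radial (s : ℝ) :
    HasDerivAt (fun s : ℝ => (s / √(s ^ 2 + 1)) ^ 3 / 3) (s ^ 2 * (√(s ^ 2 + 1) ^ 5)⁻¹) s := by
  have hp : (0 : ℝ) < s ^ 2 + 1 := by positivity
  have h1 := (((hasDerivAt_id s).pow 2).add_const 1).sqrt hp.ne'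
  have h2 := (((hasDerivAt_id s).div h1 (Real.sqrt_pos.2 hp).ne').pow 3).div_const 3
  refine h2.congr_deriv ?_
  have h3 : √(s ^ 2 + 1) ≠ 0 := (Real.sqrt_pos.2 hp).ne'
  have h4 : √(s ^ 2 + 1) ^ 2 = s ^ 2 + 1 := Real.sq_sqrt hp.le
  simp
  field_simp
  rw [h4]
  ring

lemma tendsto_radial :
    Tendsto (fun s : ℝ => (s / √(s ^ 2 + 1)) ^ 3 / 3) atTop (𝓝 (1 / 3)) := by
  have h : Tendsto (fun s : ℝ => s / √(s ^ 2 + 1)) atTop (𝓝 1) := by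
    have h1 : Tendsto (fun s : ℝ => √(1 - (s ^ 2 + 1)⁻¹)) atTop (𝓝 (√(1 - 0))) := by
      refine (tendsto_const_nhds.sub ?_).sqrt
      exact tendsto_inv_atTop_zero.comp
        (tendsto_atTop_add_const_right _ _ (tendsto_pow_atTop two_ne_zero))
    rw [sub_zero, Real.sqrt_one] at h1
    refine h1.congr' ?_
    filter_upwards [eventually_ge_atTop 0] with s hs
    have hp : (0 : ℝ) < s ^ 2 + 1 := by positivity
    rw [show 1 - (s ^ 2 + 1)⁻¹ = s ^ 2 / (s ^ 2 + 1) by field_simp; ring,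
      Real.sqrt_div (sq_nonneg s), Real.sqrt_sq hs]
  simpa using (h.pow 3).div_const 3

lemma integrable_regNorm_one : Integrable fun y : E3 => (regNorm 1 y ^ 5)⁻¹ := by
  have := integrable_fun_norm_addHaar (volume : Measure E3)
    (f := fun s : ℝ => (√(s ^ 2 + 1) ^ 5)⁻¹)
  simp only [finrank_euclideanSpace, Fintype.card_fin, smul_eq_mul] at this
  simp only [regNorm, one_pow]
  have h := integrableOn_Ioi_deriv_of_nonneg' (a := (0 : ℝ)) (fun s _ => hasDerivAt_radial s)
    (fun s _ => by positivity) tendsto_radial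
  exact this.2 h

lemma integral_regNorm_one : ∫ y : E3, (regNorm 1 y ^ 5)⁻¹ = 4 * Real.pi / 3 := by
  have := integral_fun_norm_addHaar (volume : Measure E3) (fun s : ℝ => (√(s ^ 2 + 1) ^ 5)⁻¹)
  simp only [finrank_euclideanSpace, Fintype.card_fin, smul_eq_mul] at this
  simp only [regNorm, one_pow]
  rw [this, integral_Ioi_of_hasDerivAt_of_nonneg' (fun s _ => hasDerivAt_radial s)
    (fun s _ => by positivity) tendsto_radial]
  have : 0 ≤ Real.pi * 4 / 3 := by positivity
  rw [Measure.real, EuclideanSpace.volume_ball_fin_three]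
  simp only [ENNReal.ofReal_one, one_pow, one_mul, ENNReal.toReal_ofReal this]
  ring_nf

lemma regNorm_smul {ε : ℝ} (hε : 0 < ε) (y : E3) : regNorm ε (ε • y) = ε * regNorm 1 y := by
  rw [regNorm, regNorm, norm_smul, Real.norm_eq_abs, abs_of_pos hε,
    show (ε * ‖y‖) ^ 2 + ε ^ 2 = ε ^ 2 * (‖y‖ ^ 2 + 1 ^ 2) by ring,
    Real.sqrt_mul (sq_nonneg ε), Real.sqrt_sq hε.le]

lemma tendsto_integral_concentrating {g : ℝ × E3 → ℝ} (hg : Continuous g)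
    {C : ℝ} (hC : ∀ z, ‖g z‖ ≤ C) :
    Tendsto (fun ε => ∫ y, 3 * ε ^ 2 / regNorm ε y ^ 5 * g (regNorm ε y, y)) (𝓝[>] 0)
      (𝓝 (4 * Real.pi * g 0)) := by
  have h1 : ∀ ε : ℝ, 0 < ε → ∫ y, 3 * (regNorm 1 y ^ 5)⁻¹ * g (ε * regNorm 1 y, ε • y) =
      ∫ y, 3 * ε ^ 2 / regNorm ε y ^ 5 * g (regNorm ε y, y) := fun ε hε => by
    have h2 := Measure.integral_comp_smul volume
      (fun y => 3 * ε ^ 2 / regNorm ε y ^ 5 * g (regNorm ε y, y)) ε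
    simp only [finrank_euclideanSpace, Fintype.card_fin, smul_eq_mul, regNorm_smul hε] at h2
    rw [abs_of_pos (by positivity), eq_comm, inv_mul_eq_iff_eq_mul₀ (by positivity)] at h2
    rw [h2, ← integral_const_mul]
    congr 1 with y
    have := (regNorm_pos one_pos y).ne'
    field_simp
  have h3 : Tendsto (fun ε : ℝ => ∫ y, 3 * (regNorm 1 y ^ 5)⁻¹ * g (ε * regNorm 1 y, ε • y))
      (𝓝[>] 0) (𝓝 (∫ y, 3 * (regNorm 1 y ^ 5)⁻¹ * g 0)) := by
    have hcont := continuous_regNorm 1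
    have hmeas : AEStronglyMeasurable (fun y : E3 => (regNorm 1 y ^ 5)⁻¹) :=
      integrable_regNorm_one.1
    refine tendsto_integral_filter_of_dominated_convergence
      (fun y => 3 * (regNorm 1 y ^ 5)⁻¹ * C) (Eventually.of_forall fun ε => ?_)
      (Eventually.of_forall fun ε => Eventually.of_forall fun y => ?_)
      ((integrable_regNorm_one.const_mul 3).mul_const C) (Eventually.of_forall fun y => ?_)
    · have hgc : Continuous fun y => g (ε * regNorm 1 y, ε • y) := by fun_prop
      exact (hmeas.const_mul 3).mul hgc.aestronglyMeasurable
    · have := regNorm_pos one_pos y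
      rw [norm_mul, Real.norm_of_nonneg (by positivity)]
      exact mul_le_mul_of_nonneg_left (hC _) (by positivity)
    · have hgc : Continuous fun ε : ℝ => 3 * (regNorm 1 y ^ 5)⁻¹ * g (ε * regNorm 1 y, ε • y) := by
        fun_prop
      have := hgc.tendsto 0
      simp only [zero_mul, zero_smul] at this
      exact this.mono_left nhdsWithin_le_nhds
  rw [integral_mul_const, integral_const_mul, integral_regNorm_one] at h3
  rw [show 4 * Real.pi * g 0 = 3 * (4 * Real.pi / 3) * g 0 by ring]
  refine h3.congr' ?_
  filter_upwards [self_mem_nhdsWithin] with ε hε using h1 ε hε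

lemma integrableOn_norm_inv (R : ℝ) : IntegrableOn (fun y : E3 => ‖y‖⁻¹) (ball 0 R) := by
  rw [integrableOn_fun_norm_addHaar (volume : Measure E3) (f := fun s : ℝ => s⁻¹)]
  have h : IntegrableOn (fun s : ℝ => s) (Ioo 0 R) :=
    (continuous_id.integrableOn_Icc (a := 0) (b := R)).mono_set Ioo_subset_Icc_self
  refine h.congr_fun (fun s hs => ?_) measurableSet_Ioo
  have := hs.1.ne'
  simp
  field_simp

lemma integrableOn_norm_sq_inv (R : ℝ) :
    IntegrableOn (fun y : E3 => (‖y‖ ^ 2)⁻¹) (ball 0 R) := by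
  rw [integrableOn_fun_norm_addHaar (volume : Measure E3) (f := fun s : ℝ => (s ^ 2)⁻¹)]
  have h : IntegrableOn (fun _ : ℝ => (1 : ℝ)) (Ioo 0 R) :=
    (continuous_const.integrableOn_Icc (a := 0) (b := R)).mono_set Ioo_subset_Icc_self
  refine h.congr_fun (fun s hs => ?_) measurableSet_Ioo
  have := hs.1.ne'
  simp
  field_simp

/-- Kirchhoff's formula: the inverse distance on the forward light cone is, up to the factor
`4π`, a fundamental solution of the d'Alembert operator. -/
lemma integral_box_cone {g : ℝ × E3 → ℝ} (hg : ContDiff ℝ ∞ g) (hs : HasCompactSupport g) :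
    ∫ y, box g (‖y‖, y) / ‖y‖ = 4 * Real.pi * g 0 := by
  obtain ⟨R, hR, hz⟩ := exists_radius hs
  have hDc : Continuous (fderiv ℝ g) := hg.continuous_fderiv (by simp)
  have hSc := continuous_sndDeriv hg (1, 0) (1, 0)
  have hbc := continuous_box hg
  have hs1 : HasCompactSupport (fderiv ℝ g) := hs.fderiv ℝ
  have hs2 : HasCompactSupport (fderiv ℝ (fderiv ℝ g)) := hs1.fderiv ℝ
  obtain ⟨C0, hC0⟩ := hs.exists_bound_of_continuous hg.continuous
  obtain ⟨C1, hC1⟩ : ∃ C, ∀ z, ‖fderiv ℝ g z (1, 0)‖ ≤ C :=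
    (hs1.comp_left (g := fun L : ℝ × E3 →L[ℝ] ℝ => L (1, 0)) rfl).exists_bound_of_continuous
      (by fun_prop)
  obtain ⟨C2, hC2⟩ : ∃ C, ∀ z, ‖sndDeriv g (1, 0) (1, 0) z‖ ≤ C :=
    (hs2.comp_left (g := fun L : ℝ × E3 →L[ℝ] ℝ × E3 →L[ℝ] ℝ => L (1, 0) (1, 0))
      rfl).exists_bound_of_continuous hSc
  obtain ⟨C3, hC3⟩ : ∃ C, ∀ z, ‖box g z‖ ≤ C :=
    (hs2.comp_left (g := fun L : ℝ × E3 →L[ℝ] ℝ × E3 →L[ℝ] ℝ =>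
      L (1, 0) (1, 0) - ∑ i, L (0, ee i) (0, ee i)) (by simp)).exists_bound_of_continuous hbc
  have h1 := tendsto_integral_concentrating hg.continuous hC0
  refine tendsto_nhds_unique ?_ h1
  have h2 : Tendsto (fun ε => ∫ y, (box g (regNorm ε y, y) / regNorm ε y
      - ε ^ 2 / regNorm ε y ^ 3 * sndDeriv g (1, 0) (1, 0) (regNorm ε y, y)
      + 3 * ε ^ 2 / regNorm ε y ^ 4 * fderiv ℝ g (regNorm ε y, y) (1, 0))) (𝓝[>] 0)
      (𝓝 (∫ y, box g (‖y‖, y) / ‖y‖)) := by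
    refine tendsto_integral_filter_of_dominated_convergence
      ((ball 0 R).indicator fun y => C3 * ‖y‖⁻¹ + C2 * ‖y‖⁻¹ + 3 * C1 * (‖y‖ ^ 2)⁻¹) ?_ ?_ ?_ ?_
    · filter_upwards [self_mem_nhdsWithin] with ε hε
      have hr : ∀ y, regNorm ε y ≠ 0 := fun y => (regNorm_pos hε y).ne'
      have hr3 : ∀ y, regNorm ε y ^ 3 ≠ 0 := fun y => pow_ne_zero _ (hr y)
      have hr4 : ∀ y, regNorm ε y ^ 4 ≠ 0 := fun y => pow_ne_zero _ (hr y)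
      have hrc := continuous_regNorm ε
      exact Continuous.aestronglyMeasurable (by fun_prop (disch := assumption))
    · filter_upwards [self_mem_nhdsWithin] with ε hε
      have hε : 0 < ε := hε
      filter_upwards [compl_mem_ae_iff.2 (measure_singleton (0 : E3))] with y hy
      have hy0 : 0 < ‖y‖ := norm_pos_iff.2 hy
      by_cases hyR : y ∈ ball (0 : E3) R
      · rw [indicator_of_mem hyR]
        have hr := regNorm_pos hε y
        have ha := norm_le_regNorm ε y
        have hb : ε ^ 2 ≤ regNorm ε y ^ 2 := pow_le_pow_left₀ hε.le (le_regNorm ε y) 2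
        have hr2 := sq_nonneg (regNorm ε y)
        have e1 : ‖(regNorm ε y)⁻¹‖ ≤ ‖y‖⁻¹ := by
          rw [Real.norm_of_nonneg (by positivity)]
          exact inv_anti₀ hy0 ha
        have e2 : ‖ε ^ 2 / regNorm ε y ^ 3‖ ≤ ‖y‖⁻¹ := by
          rw [Real.norm_of_nonneg (by positivity), div_le_iff₀ (by positivity),
            inv_mul_eq_div, le_div_iff₀ hy0, pow_succ]
          exact mul_le_mul hb ha hy0.le hr2
        have e3 : ‖3 * ε ^ 2 / regNorm ε y ^ 4‖ ≤ 3 * (‖y‖ ^ 2)⁻¹ := by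
          have := pow_le_pow_left₀ hy0.le ha 2
          rw [Real.norm_of_nonneg (by positivity), div_le_iff₀ (by positivity), mul_assoc,
            inv_mul_eq_div, mul_le_mul_iff_right₀ (by norm_num), le_div_iff₀ (by positivity),
            show 4 = 2 + 2 from rfl, pow_add]
          exact mul_le_mul hb this (by positivity) hr2
        refine (norm_add_le _ _).trans (add_le_add ((norm_sub_le _ _).trans (add_le_add ?_ ?_)) ?_)
        · rw [div_eq_mul_inv, norm_mul]
          exact mul_le_mul (hC3 _) e1 (norm_nonneg _) ((norm_nonneg _).trans (hC3 0))
        · rw [norm_mul, mul_comm]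
          exact mul_le_mul (hC2 _) e2 (norm_nonneg _) ((norm_nonneg _).trans (hC2 0))
        · rw [norm_mul, mul_comm, mul_comm 3 C1, mul_assoc]
          exact mul_le_mul (hC1 _) e3 (norm_nonneg _) ((norm_nonneg _).trans (hC1 0))
      · rw [indicator_of_notMem hyR]
        obtain ⟨k1, k2, k3⟩ := hz (regNorm ε y, y) (by simpa using hyR)
        simp [box, sndDeriv, k2, k3]
    · rw [integrable_indicator_iff measurableSet_ball]
      have i1 := integrableOn_norm_inv R
      have i2 := integrableOn_norm_sq_inv R
      exact ((i1.const_mul C3).add (i1.const_mul C2)).add (i2.const_mul (3 * C1))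
    · filter_upwards [compl_mem_ae_iff.2 (measure_singleton (0 : E3))] with y hy
      have hy0 : ‖y‖ ≠ 0 := norm_ne_zero_iff.2 hy
      have hr0 : regNorm 0 y = ‖y‖ := by simp [regNorm]
      have hrc : Continuous fun ε => regNorm ε y := by unfold regNorm; fun_prop
      have k1 : ContinuousAt (fun ε => box g (regNorm ε y, y) / regNorm ε y
          - ε ^ 2 / regNorm ε y ^ 3 * sndDeriv g (1, 0) (1, 0) (regNorm ε y, y)
          + 3 * ε ^ 2 / regNorm ε y ^ 4 * fderiv ℝ g (regNorm ε y, y) (1, 0)) 0 := by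
        have q1 : regNorm 0 y ≠ 0 := by rwa [hr0]
        have q3 := pow_ne_zero 3 q1
        have q4 := pow_ne_zero 4 q1
        fun_prop (disch := assumption)
      have k2 := k1.tendsto
      simp only [hr0] at k2
      simpa using k2.mono_left nhdsWithin_le_nhds
  refine h2.congr' ?_
  filter_upwards [self_mem_nhdsWithin] with ε hε using integral_regularized hg hs hε

lemma exists_bound_fderiv {G : Type} [NormedAddCommGroup G] [NormedSpace ℝ G] {g : ℝ × E3 → G}
    (hg : ContDiff ℝ ∞ g) (hs : HasCompactSupport g) : ∃ C, ∀ z, ‖fderiv ℝ g z‖ ≤ C :=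
  (hs.fderiv ℝ).exists_bound_of_continuous (hg.continuous_fderiv (by simp))

lemma sndDeriv_coneInt {k : E3 → ℝ} (hk : Integrable k) {g : ℝ × E3 → ℝ} (hg : ContDiff ℝ ∞ g)
    (hs : HasCompactSupport g) (u v z : ℝ × E3) :
    Integrable (fun y => k y • sndDeriv g u v (z + (‖y‖, y))) ∧
      sndDeriv (coneInt k g) u v z = coneInt k (sndDeriv g u v) z := by
  have hg1 : ContDiff ℝ ∞ (fderiv ℝ g) := hg.fderiv_right (by simp)
  have hg2 : Continuous (fderiv ℝ (fderiv ℝ g)) := hg1.continuous_fderiv (by simp)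
  have hs1 : HasCompactSupport (fderiv ℝ g) := hs.fderiv ℝ
  obtain ⟨C0, hC0⟩ := hs.exists_bound_of_continuous hg.continuous
  obtain ⟨C1, hC1⟩ := hs1.exists_bound_of_continuous hg1.continuous
  obtain ⟨C2, hC2⟩ := exists_bound_fderiv hg1 hs1
  have e1 : fderiv ℝ (coneInt k g) = coneInt k (fderiv ℝ g) := funext fun z =>
    (hasFDerivAt_coneInt hk (hg.of_le (by simp)) hC0 hC1 z).fderiv
  have e2 : fderiv ℝ (coneInt k (fderiv ℝ g)) z = coneInt k (fderiv ℝ (fderiv ℝ g)) z :=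
    (hasFDerivAt_coneInt hk (hg1.of_le (by simp)) hC1 hC2 z).fderiv
  have i1 := integrable_cone hk hg2 hC2 z
  have i2 := i1.apply_continuousLinearMap u
  have i3 := i2.apply_continuousLinearMap v
  refine ⟨i3, ?_⟩
  rw [sndDeriv, e1, e2, coneInt, ContinuousLinearMap.integral_apply i1,
    ContinuousLinearMap.integral_apply i2]
  rfl

lemma box_coneInt {k : E3 → ℝ} (hk : Integrable k) {g : ℝ × E3 → ℝ} (hg : ContDiff ℝ ∞ g)
    (hs : HasCompactSupport g) (z : ℝ × E3) : box (coneInt k g) z = coneInt k (box g) z := by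
  have h := sndDeriv_coneInt hk hg hs
  simp only [box, (h _ _ z).2, coneInt]
  rw [← integral_finsetSum _ fun i _ => (h _ _ z).1, ← integral_sub (h _ _ z).1
    (integrable_finsetSum _ fun i _ => (h _ _ z).1)]
  simp only [smul_sub, Finset.smul_sum]

lemma box_comp_const_add (g : ℝ × E3 → ℝ) (z w : ℝ × E3) :
    box (fun w => g (z + w)) w = box g (z + w) := by
  have e1 : fderiv ℝ (fun w => g (z + w)) = fun w => fderiv ℝ g (z + w) :=
    funext fun w => fderiv_comp_add_left z
  have e2 : fderiv ℝ (fun w => fderiv ℝ g (z + w)) w = fderiv ℝ (fderiv ℝ g) (z + w) :=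
    fderiv_comp_add_left z
  simp only [box, sndDeriv, e1, e2]

lemma box_eq_zero {g : ℝ × E3 → ℝ} {T : ℝ} (hT : ∀ z : ℝ × E3, T ≤ z.1 → g z = 0) {z : ℝ × E3}
    (hz : T < z.1) : box g z = 0 := by
  have h : g =ᶠ[𝓝 z] fun _ => 0 := by
    filter_upwards [(isOpen_lt continuous_const continuous_fst).mem_nhds hz] with w hw
      using hT w (le_of_lt hw)
  have h1 := h.fderiv (𝕜 := ℝ)
  have h2 := (h1.fderiv (𝕜 := ℝ)).eq_of_nhds
  have h3 : fderiv ℝ (fderiv ℝ g) z = 0 := by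
    rw [h2]; simp
  simp [box, sndDeriv, h3]

/-- The inverse distance kernel of the forward light cone, truncated at radius `ρ`. -/
def coneKernel (ρ : ℝ) : E3 → ℝ := (ball 0 ρ).indicator fun y => (4 * Real.pi)⁻¹ * ‖y‖⁻¹

lemma integrable_coneKernel (ρ : ℝ) : Integrable (coneKernel ρ) :=
  (integrable_indicator_iff measurableSet_ball).2 ((integrableOn_norm_inv ρ).const_mul _)

lemma coneKernel_nonneg (ρ : ℝ) (y : E3) : 0 ≤ coneKernel ρ y :=
  indicator_nonneg (fun _ _ => by positivity) y

/-- Duhamel's principle for the backward wave equation. -/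
lemma box_coneInt_coneKernel {g : ℝ × E3 → ℝ} (hg : ContDiff ℝ ∞ g) (hs : HasCompactSupport g)
    {T ρ : ℝ} (hT : ∀ z : ℝ × E3, T ≤ z.1 → g z = 0) {z : ℝ × E3} (hz : T - z.1 < ρ) :
    box (coneInt (coneKernel ρ) g) z = g z := by
  have h1 := integral_box_cone (g := fun w => g (z + w)) (by fun_prop)
    (hs.comp_homeomorph (Homeomorph.addLeft z))
  rw [add_zero] at h1
  have hpi : 4 * Real.pi ≠ 0 := by positivity
  rw [box_coneInt (integrable_coneKernel ρ) hg hs, coneInt, ← mul_right_inj' hpi, ← h1,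
    ← integral_const_mul]
  congr 1 with y
  rw [box_comp_const_add]
  by_cases hy : y ∈ ball (0 : E3) ρ
  · rw [coneKernel, indicator_of_mem hy, smul_eq_mul]
    field_simp
  · have hy' : ρ ≤ ‖y‖ := by simpa using hy
    have : box g (z + (‖y‖, y)) = 0 := box_eq_zero hT (by simp; linarith)
    simp [this]

lemma deriv_deriv_eq_sndDeriv {g : ℝ × E3 → ℝ} (hg : ContDiff ℝ ∞ g) (t : ℝ) (x : E3) :
    deriv (fun s => deriv (fun r => g (r, x)) s) t = sndDeriv g (1, 0) (1, 0) (t, x) := by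
  have hg1 : ContDiff ℝ ∞ (fderiv ℝ g) := hg.fderiv_right (by simp)
  have hl : ∀ s : ℝ, HasDerivAt (fun s : ℝ => (s, x)) ((1 : ℝ), (0 : E3)) s := fun s =>
    (hasDerivAt_id s).prodMk (hasDerivAt_const s x)
  have e1 : (fun s => deriv (fun r => g (r, x)) s) = fun s => fderiv ℝ g (s, x) (1, 0) :=
    funext fun s => (((hg.differentiable (by simp)) (s, x)).hasFDerivAt.comp_hasDerivAt s
      (hl s)).deriv
  rw [e1]
  have h1 := ((hg1.differentiable (by simp)) (t, x)).hasFDerivAt.comp_hasDerivAt t (hl t)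
  have h2 := h1.clm_apply (hasDerivAt_const t ((1 : ℝ), (0 : E3)))
  refine h2.deriv.trans ?_
  simp [sndDeriv]

lemma lap3_eq_sum_sndDeriv {g : ℝ × E3 → ℝ} (hg : ContDiff ℝ ∞ g) (t : ℝ) (x : E3) :
    lap3 (fun y => g (t, y)) x = ∑ i, sndDeriv g (0, ee i) (0, ee i) (t, x) := by
  have hg1 : ContDiff ℝ ∞ (fderiv ℝ g) := hg.fderiv_right (by simp)
  have hl : ∀ y : E3, HasFDerivAt (fun y : E3 => (t, y)) (ContinuousLinearMap.inr ℝ ℝ E3) y :=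
    fun y => hasFDerivAt_prodMk_right t y
  have e1 : ∀ y, fderiv ℝ (fun y => g (t, y)) y =
      (fderiv ℝ g (t, y)).comp (ContinuousLinearMap.inr ℝ ℝ E3) := fun y =>
    (((hg.differentiable (by simp)) (t, y)).hasFDerivAt.comp y (hl y)).fderiv
  have e2 : ∀ i y, gradient (fun y => g (t, y)) y i = fderiv ℝ g (t, y) (0, ee i) := fun i y => by
    have h := inner_gradient_left (𝕜 := ℝ) (f := fun y => g (t, y)) (x := y) (y := ee i)
    rw [EuclideanSpace.inner_single_right, e1] at h
    simpa using h
  have hgrad : Differentiable ℝ (gradient fun y => g (t, y)) := by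
    have h1 : ContDiff ℝ ∞ fun y => g (t, y) := by fun_prop
    have h2 : ContDiff ℝ ∞ (fderiv ℝ fun y => g (t, y)) := h1.fderiv_right (by simp)
    exact (InnerProductSpace.toDual ℝ E3).symm.toContinuousLinearEquiv.differentiable.comp
      (h2.differentiable (by simp))
  rw [lap3, div3]
  refine Finset.sum_congr rfl fun i _ => ?_
  have h1 := ((EuclideanSpace.proj (𝕜 := ℝ) i).hasFDerivAt.comp x (hgrad x).hasFDerivAt)
  have h2 : HasFDerivAt (fun y => fderiv ℝ g (t, y) (0, ee i)) _ x :=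
    (((hg1.differentiable (by simp)) (t, x)).hasFDerivAt.comp x (hl x)).clm_apply
      (hasFDerivAt_const ((0 : ℝ), ee i) x)
  have h3 := h1.unique (h2.congr_of_eventuallyEq (Eventually.of_forall fun y => e2 i y))
  have h4 := DFunLike.congr_fun h3 (ee i)
  simpa [sndDeriv] using h4

lemma exists_exp_weight {k : E3 → ℝ} (hk : Integrable k) (C : ℝ) :
    ∃ l : ℝ, 0 ≤ l ∧ Integrable (fun y => k y * Real.exp (-l * ‖y‖)) ∧
      (∫ y, |k y * Real.exp (-l * ‖y‖)|) * C ≤ 1 / 2 := by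
  have hexp : ∀ l : ℝ, 0 ≤ l → ∀ y : E3, ‖Real.exp (-l * ‖y‖)‖ ≤ 1 := fun l hl y => by
    rw [Real.norm_of_nonneg (Real.exp_nonneg _), Real.exp_le_one_iff]
    nlinarith [mul_nonneg hl (norm_nonneg y)]
  have hcont : ∀ l : ℝ, Continuous fun y : E3 => Real.exp (-l * ‖y‖) := fun l => by fun_prop
  have h1 : Tendsto (fun l : ℝ => ∫ y, |k y * Real.exp (-l * ‖y‖)|) atTop (𝓝 (∫ _ : E3, 0)) := by
    refine tendsto_integral_filter_of_dominated_convergence (fun y => |k y|)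
      (Eventually.of_forall fun l => (hk.1.mul (hcont l).aestronglyMeasurable).norm) ?_ hk.abs ?_
    · filter_upwards [eventually_ge_atTop 0] with l hl
      refine Eventually.of_forall fun y => ?_
      rw [Real.norm_eq_abs, abs_abs, abs_mul]
      exact mul_le_of_le_one_right (abs_nonneg _) (hexp l hl y)
    · filter_upwards [compl_mem_ae_iff.2 (measure_singleton (0 : E3))] with y hy
      have hy0 : 0 < ‖y‖ := norm_pos_iff.2 hy
      have h2 : Tendsto (fun l : ℝ => Real.exp (-l * ‖y‖)) atTop (𝓝 0) := by
        refine Real.tendsto_exp_atBot.comp ?_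
        exact tendsto_neg_atTop_atBot.atBot_mul_const hy0
      simpa using (h2.const_mul (k y)).abs
  have h3 := h1.mul_const C
  rw [integral_zero, zero_mul] at h3
  obtain ⟨l, hl, hl'⟩ := ((h3.eventually_le_const (by norm_num : (0 : ℝ) < 1 / 2)).and
    (eventually_ge_atTop 0)).exists
  exact ⟨l, hl', hk.smul_bdd 1 (hcont l).aestronglyMeasurable
    (Eventually.of_forall (hexp l hl')), hl⟩

lemma coneInt_exp_weight (k : E3 → ℝ) (g : ℝ × E3 → ℝ) (l : ℝ) (z : ℝ × E3) :
    coneInt (fun y => k y * Real.exp (-l * ‖y‖)) (fun z => Real.exp (l * z.1) * g z) z =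
      Real.exp (l * z.1) * coneInt k g z := by
  rw [coneInt, coneInt, ← integral_const_mul]
  congr 1 with y
  have : Real.exp (-l * ‖y‖) * Real.exp (l * (z.1 + ‖y‖)) = Real.exp (l * z.1) := by
    rw [← Real.exp_add]; congr 1; ring
  simp only [smul_eq_mul, Prod.fst_add]
  rw [← this]
  ring

/-- Solution of the backward wave equation with compactly supported potential, through its Duhamel
representation. -/
lemma exists_duhamel_solution {W F : ℝ × E3 → ℝ} (hW : ContDiff ℝ ∞ W) (hWs : HasCompactSupport W)
    (hF : ContDiff ℝ ∞ F) (hFs : HasCompactSupport F) (ρ : ℝ) :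
    ∃ φ : ℝ × E3 → ℝ, ContDiff ℝ ∞ φ ∧ (∃ C, ∀ z : ℝ × E3, 0 ≤ z.1 → |φ z| ≤ C) ∧
      (∀ z, φ z = coneInt (coneKernel ρ) (fun z => F z - W z * φ z) z) ∧
      ∀ S : Set (ℝ × E3), (∀ z y, z + (‖y‖, y) ∈ S → z ∈ S) → (∀ z ∉ S, F z = 0) →
        ∀ z ∉ S, φ z = 0 := by
  have hk := integrable_coneKernel ρ
  choose w hw using (BddSmooth.of_hasCompactSupport hW.neg hWs.neg).2
  obtain ⟨l, hl, hki, hks⟩ := exists_exp_weight hk (w 0)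
  have hexp : ∀ l : ℝ, ContDiff ℝ ∞ fun z : ℝ × E3 => Real.exp (l * z.1) := fun l => by fun_prop
  obtain ⟨ψ, hψ, ⟨C, hC⟩, hfix, hsupp⟩ := exists_smooth_fixedPoint hki hW.neg
    (BddSmooth.of_hasCompactSupport ((hexp l).mul hF) hFs.mul_left) hw hks
  have hee : ∀ s : ℝ, Real.exp (l * s) * Real.exp (-l * s) = 1 := fun s => by
    rw [← Real.exp_add]; simp
  have hφ : ContDiff ℝ ∞ fun z : ℝ × E3 => Real.exp (-l * z.1) * ψ z := (hexp (-l)).mul hψ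
  refine ⟨fun z => Real.exp (-l * z.1) * ψ z, hφ, ⟨C, fun z hz => ?_⟩, fun z => ?_,
    fun S hS hFS z hz => ?_⟩
  · have h1 : Real.exp (-l * z.1) ≤ 1 := Real.exp_le_one_iff.2 (by nlinarith [mul_nonneg hl hz])
    rw [abs_mul, abs_of_pos (Real.exp_pos _)]
    exact (mul_le_of_le_one_left (abs_nonneg _) h1).trans (hC z)
  · have hWφ : HasCompactSupport fun z => W z * (Real.exp (-l * z.1) * ψ z) := hWs.mul_right
    obtain ⟨CF, hCF⟩ := hFs.exists_bound_of_continuous hF.continuous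
    obtain ⟨CW, hCW⟩ := hWφ.exists_bound_of_continuous (hW.mul hφ).continuous
    have e1 : (fun z => -W z * ψ z) =
        fun z => Real.exp (l * z.1) * -(W z * (Real.exp (-l * z.1) * ψ z)) := funext fun z => by
      linear_combination (-W z * ψ z) * (-(hee z.1))
    have e2 := hfix z
    rw [e1, coneInt_exp_weight, coneInt_exp_weight] at e2
    beta_reduce
    rw [e2, ← mul_add, ← mul_assoc, mul_comm (Real.exp (-l * z.1)), hee, one_mul, coneInt, coneInt,
      coneInt, ← integral_add (integrable_cone hk hF.continuous hCF z) (integrable_cone hk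
        (hW.mul hφ).neg.continuous (C := CW) (fun z => by simpa using hCW z) z)]
    congr 1 with y
    simp only [smul_eq_mul]
    ring
  · beta_reduce
    rw [hsupp S hS (fun z hz => by simp [hFS z hz]) z hz, mul_zero]

lemma integrableOn_div_norm {g : E3 → ℝ} (hg : Continuous g) (R : ℝ) :
    IntegrableOn (fun y => g y / ‖y‖) (ball 0 R) := by
  have h1 : IntegrableOn (fun y : E3 => ‖y‖⁻¹) (closedBall 0 R) :=
    (integrableOn_norm_inv (R + 1)).mono_set (closedBall_subset_ball (by linarith))
  have h2 := (h1.continuousOn_mul hg.continuousOn (isCompact_closedBall 0 R)).mono_set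
    ball_subset_closedBall
  simpa only [div_eq_mul_inv] using h2

/-- The solution given by Duhamel's formula is bounded by truncated cone integrals. -/
lemma abs_coneInt_coneKernel_le {g F V : ℝ × E3 → ℝ} (hF : Continuous F) (hV : Continuous V)
    {M T t ρ : ℝ} (x : E3)
    (hg : ∀ z : ℝ × E3, t ≤ z.1 → z.1 < T → |g z| ≤ |F z| + M * |V z|)
    (hgT : ∀ z : ℝ × E3, T ≤ z.1 → g z = 0) :
    |coneInt (coneKernel ρ) g (t, x)| ≤
      (4 * Real.pi)⁻¹ * ((∫ y in ball (0 : E3) (T - t), |F (t + ‖y‖, x + y)| / ‖y‖)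
        + M * ∫ y in ball (0 : E3) (T - t), |V (t + ‖y‖, x + y)| / ‖y‖) := by
  have i1 := integrableOn_div_norm (g := fun y => |F (t + ‖y‖, x + y)|) (by fun_prop) (T - t)
  have i2 := integrableOn_div_norm (g := fun y => |V (t + ‖y‖, x + y)|) (by fun_prop) (T - t)
  rw [← integral_const_mul, ← integral_add i1 (i2.const_mul M), ← integral_const_mul,
    ← integral_indicator measurableSet_ball]
  have hint := (integrable_indicator_iff (μ := volume) measurableSet_ball).2
    ((i1.add (i2.const_mul M)).const_mul (4 * Real.pi)⁻¹)
  rw [← Real.norm_eq_abs, coneInt]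
  refine norm_integral_le_of_norm_le hint (Eventually.of_forall fun y => ?_)
  by_cases hy : y ∈ ball (0 : E3) (T - t)
  · have hy' : ‖y‖ < T - t := by simpa using hy
    have hk : coneKernel ρ y ≤ (4 * Real.pi)⁻¹ * ‖y‖⁻¹ :=
      indicator_le_self' (fun _ _ => by positivity) y
    have h1 := hg (t + ‖y‖, x + y) (by simp) (by simp; linarith)
    rw [indicator_of_mem hy, norm_smul, Real.norm_of_nonneg (coneKernel_nonneg ρ y)]
    calc _ ≤ (4 * Real.pi)⁻¹ * ‖y‖⁻¹ * (|F (t + ‖y‖, x + y)| + M * |V (t + ‖y‖, x + y)|) :=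
          mul_le_mul hk h1 (abs_nonneg _) (by positivity)
      _ = _ := by ring
  · have hy' : T - t ≤ ‖y‖ := by simpa using hy
    rw [indicator_of_notMem hy, Prod.mk_add_mk, hgT _ (by simp; linarith), smul_zero, norm_zero]

/-- Solvability of the (regularized) backward dual problem
`□φ + Vφ = F`, `φ(T) = ∂ₜφ(T) = 0` for a smooth potential `V` whose weighted forward-cone
integrals are uniformly `≤ 1/2`: there is a smooth solution `φ`, compactly supported in
space, with `‖φ‖_{L^∞([0,T]×ℝ³)} ≤ 2 sup_{(t₀,x₀)} √2 ∫_{B(0,T-t₀)} |F(t₀+|y|,x₀+y)|/|y| dy`. -/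
theorem dual_problem_solvable (T : ℝ) (hT : 0 < T)
    (V : ℝ × E3 → ℝ) (hV : ContDiff ℝ (⊤ : ℕ∞) V)
    (hVsmall : ∀ t₀ ∈ Set.Icc (0:ℝ) T, ∀ x₀ : E3,
      Real.sqrt 2 * ∫ y in Metric.ball (0:E3) (T - t₀), |V (t₀ + ‖y‖, x₀ + y)| / ‖y‖
        ≤ 1/2)
    (F : ℝ × E3 → ℝ) (hF : ContDiff ℝ (⊤ : ℕ∞) F) (hFsupp : HasCompactSupport F)
    (hFsupp' : tsupport F ⊆ Set.Ioo (0:ℝ) T ×ˢ (Set.univ : Set E3)) :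
    ∃ φ : ℝ × E3 → ℝ,
      -- φ is smooth
      ContDiff ℝ (⊤ : ℕ∞) φ
      -- φ is compactly supported in the space variable
      ∧ (∃ R : ℝ, ∀ t ∈ Set.Icc (0:ℝ) T, ∀ x : E3, R ≤ ‖x‖ → φ (t, x) = 0)
      -- φ solves ∂ₜ²φ - Δφ + Vφ = F on [0,T] × ℝ³
      ∧ (∀ t ∈ Set.Icc (0:ℝ) T, ∀ x : E3,
          deriv (fun s => deriv (fun r => φ (r, x)) s) t - lap3 (fun y => φ (t, y)) x
            + V (t, x) * φ (t, x) = F (t, x))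
      -- zero data at time T
      ∧ (∀ x : E3, φ (T, x) = 0 ∧ deriv (fun s => φ (s, x)) T = 0)
      -- the L^∞ bound by twice the sup of the weighted cone integrals of |F|
      ∧ (∀ CF : ℝ,
          (∀ t₀ ∈ Set.Icc (0:ℝ) T, ∀ x₀ : E3,
            Real.sqrt 2 * ∫ y in Metric.ball (0:E3) (T - t₀), |F (t₀ + ‖y‖, x₀ + y)| / ‖y‖
              ≤ CF) →
          ∀ t ∈ Set.Icc (0:ℝ) T, ∀ x : E3, |φ (t, x)| ≤ 2 * CF) := by
  obtain ⟨R, hR, hFR⟩ := exists_radius hFsupp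
  have hFT : ∀ z : ℝ × E3, T ≤ z.1 → F z = 0 := fun z hz =>
    image_eq_zero_of_notMem_tsupport fun h => absurd (hFsupp' h).1.2 (not_lt.2 hz)
  let χ : ContDiffBump (0 : ℝ × E3) := ⟨R + T + 1, R + T + 2, by positivity, by linarith⟩
  have hW : ContDiff ℝ ∞ fun z => χ z * V z := χ.contDiff.mul hV
  have hWs : HasCompactSupport fun z => χ z * V z := χ.hasCompactSupport.mul_right
  have hWV : ∀ t ∈ Icc 0 T, ∀ x : E3, ‖x‖ ≤ R + T - t → χ (t, x) * V (t, x) = V (t, x) :=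
    fun t ht x hx => by
      rw [χ.one_of_mem_closedBall, one_mul]
      rw [mem_closedBall_zero_iff, Prod.norm_def, Real.norm_of_nonneg ht.1]
      exact max_le (by simp only [χ]; linarith [ht.2]) (by simp only [χ]; linarith [ht.1])
  obtain ⟨φ, hφ, ⟨C, hC⟩, hrep, hsupp⟩ := exists_duhamel_solution hW hWs hF hFsupp (T + 1)
  have hcone : ∀ z : ℝ × E3, ¬(z.1 < T ∧ ‖z.2‖ ≤ R + T - z.1) → φ z = 0 := by
    refine hsupp {z | z.1 < T ∧ ‖z.2‖ ≤ R + T - z.1} ?_ fun z hz => ?_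
    · rintro z y ⟨h1, h2⟩
      simp only [Prod.fst_add, Prod.snd_add] at h1 h2
      have h3 := norm_sub_le (z.2 + y) y
      rw [add_sub_cancel_right] at h3
      exact ⟨by linarith [norm_nonneg y], by linarith⟩
    · by_contra h
      have h1 : z.1 < T := not_le.1 fun h' => h (hFT z h')
      have h2 : ‖z.2‖ < R := not_le.1 fun h' => h (hFR z h').1
      exact hz ⟨h1, by linarith⟩
  have hφT : ∀ z : ℝ × E3, T ≤ z.1 → φ z = 0 := fun z hz => hcone z fun h => absurd h.1 (not_lt.2 hz)
  have hWφ : ∀ t ∈ Icc 0 T, ∀ x : E3, χ (t, x) * V (t, x) * φ (t, x) = V (t, x) * φ (t, x) :=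
    fun t ht x => by
      by_cases h : t < T ∧ ‖x‖ ≤ R + T - t
      · rw [hWV t ht x h.2]
      · rw [hcone (t, x) h, mul_zero, mul_zero]
  have hgs : HasCompactSupport fun z => F z - χ z * V z * φ z := hFsupp.sub hWs.mul_right
  have hgT : ∀ z : ℝ × E3, T ≤ z.1 → F z - χ z * V z * φ z = 0 := fun z hz => by
    rw [hFT z hz, hφT z hz, mul_zero, sub_zero]
  refine ⟨φ, hφ, ⟨R + T + 1, fun t ht x hx => hcone _ fun h => ?_⟩, fun t ht x => ?_,
    fun x => ⟨hφT _ le_rfl, ?_⟩, fun CF hCF => ?_⟩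
  · linarith [h.2, ht.1]
  · have h1 := box_coneInt_coneKernel (hF.sub (hW.mul hφ)) hgs hgT (ρ := T + 1) (z := (t, x))
      (by linarith [ht.1])
    rw [← funext hrep, hWφ t ht x] at h1
    rw [deriv_deriv_eq_sndDeriv hφ, lap3_eq_sum_sndDeriv hφ]
    exact add_eq_of_eq_sub h1
  · have hd : DifferentiableAt ℝ (fun s => φ (s, x)) T :=
      (ContDiff.differentiable (n := ∞) (by fun_prop) (by simp)) T
    exact (uniqueDiffWithinAt_Ici T).eq_deriv _ hd.hasDerivAt.hasDerivWithinAt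
      ((hasDerivWithinAt_const T (Ici T) (0 : ℝ)).congr (fun s hs => hφT (s, x) hs) (hφT _ le_rfl))
  · have hs2 : 1 ≤ √2 := Real.one_le_sqrt.2 (by norm_num)
    have hpi : (4 * Real.pi)⁻¹ ≤ 1 := inv_le_one_of_one_le₀ (by linarith [Real.pi_gt_three])
    let A : Set ℝ := {a | ∃ t ∈ Icc 0 T, ∃ x : E3, |φ (t, x)| = a}
    have hA : BddAbove A := ⟨C, by rintro _ ⟨t, ht, x, rfl⟩; exact hC (t, x) ht.1⟩
    have hle : ∀ t ∈ Icc 0 T, ∀ x : E3, |φ (t, x)| ≤ sSup A := fun t ht x =>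
      le_csSup hA ⟨t, ht, x, rfl⟩
    have hA0 : 0 ≤ sSup A := (abs_nonneg _).trans (hle 0 ⟨le_rfl, hT.le⟩ 0)
    have hstep : ∀ t ∈ Icc 0 T, ∀ x : E3, |φ (t, x)| ≤ CF + sSup A / 2 := fun t ht x => by
      have h1 := abs_coneInt_coneKernel_le (ρ := T + 1) (t := t) (M := sSup A) hF.continuous
        hV.continuous x (fun z hz hz' => ?_) hgT
      · rw [← hrep] at h1
        have hF1 := hCF t ht x
        have hV1 := hVsmall t ht x
        have hF0 : 0 ≤ ∫ y in ball (0 : E3) (T - t), |F (t + ‖y‖, x + y)| / ‖y‖ :=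
          integral_nonneg fun y => by positivity
        have hV0 : 0 ≤ ∫ y in ball (0 : E3) (T - t), |V (t + ‖y‖, x + y)| / ‖y‖ :=
          integral_nonneg fun y => by positivity
        have hF2 := (le_mul_of_one_le_left hF0 hs2).trans hF1
        have hV2 := (le_mul_of_one_le_left hV0 hs2).trans hV1
        have h2 := mul_le_mul_of_nonneg_left hV2 hA0
        have h3 := h1.trans (mul_le_of_le_one_left (add_nonneg hF0 (mul_nonneg hA0 hV0)) hpi)
        linarith
      · have hz0 : z.1 ∈ Icc 0 T := ⟨ht.1.trans hz, hz'.le⟩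
        have h2 := hWφ z.1 hz0 z.2
        rw [Prod.mk.eta] at h2
        rw [h2]
        refine (abs_sub _ _).trans (add_le_add le_rfl ?_)
        rw [abs_mul, mul_comm]
        exact mul_le_mul_of_nonneg_right (hle z.1 hz0 z.2) (abs_nonneg _)
    have hsup : sSup A ≤ CF + sSup A / 2 := by
      refine csSup_le ⟨_, 0, ⟨le_rfl, hT.le⟩, 0, rfl⟩ ?_
      rintro _ ⟨t, ht, x, rfl⟩
      exact hstep t ht x
    intro t ht x
    linarith [hle t ht x]
end
end

section
/- There exists a constant C > 0 such that for every R > 0 and every w ∈ C¹ on the closed ball B(0,R) ⊂ ℝ³, one has ∫_{B(0,R)} w(y)² / |y|² dy ≤ C ( ∫_{B(0,R)} |∇w(y)|² dy + ( ∫_{B(0,R)} w(y)⁶ dy )^{1/3} ). -/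
open MeasureTheory Metric
open scoped ENNReal

/-- One-dimensional Hardy inequality on `(0, R)` for the weight `r ^ 2`. -/
lemma lintegral_sq_le_of_hasDerivAt {R : ℝ} (hR : 0 < R) {f f' : ℝ → ℝ}
    (hf : ContinuousOn f (Set.Icc 0 R)) (hf' : ContinuousOn f' (Set.Icc 0 R))
    (hd : ∀ r ∈ Set.Ioo 0 R, HasDerivAt f (f' r) r) :
    ∫⁻ r in Set.Ioo 0 R, ENNReal.ofReal (f r ^ 2) ≤
      ∫⁻ r in Set.Ioo 0 R, ENNReal.ofReal (r ^ 2 * (6 / R ^ 2 * f r ^ 2 + 4 * f' r ^ 2)) := by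
  have hcont {g : ℝ → ℝ} (hg : ContinuousOn g (Set.Icc 0 R)) :
      IntegrableOn g (Set.Ioo 0 R) ∧ IntervalIntegrable g volume 0 R :=
    ⟨hg.integrableOn_Icc.mono_set Set.Ioo_subset_Icc_self,
      (Set.uIcc_of_le hR.le ▸ hg).intervalIntegrable⟩
  have h1 : ContinuousOn (fun r ↦ f r ^ 2) (Set.Icc 0 R) := by fun_prop
  have h2 : ContinuousOn (fun r ↦ r ^ 2 * (6 / R ^ 2 * f r ^ 2 + 4 * f' r ^ 2))
      (Set.Icc 0 R) := by fun_prop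
  have h3 : ContinuousOn (fun r ↦ (1 - 3 * r ^ 2 / R ^ 2) * f r ^ 2 +
      (r - r ^ 3 / R ^ 2) * (2 * f r * f' r)) (Set.Icc 0 R) := by fun_prop
  have hftc := intervalIntegral.integral_eq_sub_of_hasDerivAt_of_le
    (f := fun r ↦ (r - r ^ 3 / R ^ 2) * f r ^ 2) hR.le (by fun_prop)
    (f' := fun r ↦ (1 - 3 * r ^ 2 / R ^ 2) * f r ^ 2 +
      (r - r ^ 3 / R ^ 2) * (2 * f r * f' r)) (fun r hr ↦ by
        have := ((hasDerivAt_id r).sub ((hasDerivAt_pow 3 r).div_const (R ^ 2))).mul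
          ((hd r hr).pow 2)
        refine this.congr_deriv ?_
        simp only [id_eq, Pi.sub_apply, Pi.pow_apply, Nat.cast_ofNat]
        ring) (hcont h3).2
  have hzero : ∫ r in (0 : ℝ)..R, ((1 - 3 * r ^ 2 / R ^ 2) * f r ^ 2 +
      (r - r ^ 3 / R ^ 2) * (2 * f r * f' r)) = 0 := by
    rw [hftc]
    field_simp
    ring
  have hpt : ∀ r ∈ Set.Icc 0 R, f r ^ 2 ≤ r ^ 2 * (6 / R ^ 2 * f r ^ 2 + 4 * f' r ^ 2) +
      2 * ((1 - 3 * r ^ 2 / R ^ 2) * f r ^ 2 + (r - r ^ 3 / R ^ 2) * (2 * f r * f' r)) := by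
    intro r hr
    have hc0 : 0 ≤ r ^ 2 / R ^ 2 := by positivity
    have hc1 : r ^ 2 / R ^ 2 ≤ 1 := by
      rw [div_le_one (by positivity)]
      exact pow_le_pow_left₀ hr.1 hr.2 2
    have e : r ^ 2 * (6 / R ^ 2 * f r ^ 2 + 4 * f' r ^ 2) +
        2 * ((1 - 3 * r ^ 2 / R ^ 2) * f r ^ 2 + (r - r ^ 3 / R ^ 2) * (2 * f r * f' r)) -
        f r ^ 2 = (f r + 2 * (1 - r ^ 2 / R ^ 2) * (r * f' r)) ^ 2 +
          4 * (r * f' r) ^ 2 * (1 - (1 - r ^ 2 / R ^ 2) ^ 2) := by ring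
    have : 0 ≤ 1 - (1 - r ^ 2 / R ^ 2) ^ 2 := by nlinarith
    have : 0 ≤ (f r + 2 * (1 - r ^ 2 / R ^ 2) * (r * f' r)) ^ 2 +
          4 * (r * f' r) ^ 2 * (1 - (1 - r ^ 2 / R ^ 2) ^ 2) := by positivity
    linarith
  have hle := intervalIntegral.integral_mono_on hR.le (hcont h1).2
    ((hcont h2).2.add ((hcont h3).2.const_mul 2)) hpt
  rw [intervalIntegral.integral_add (hcont h2).2 ((hcont h3).2.const_mul 2),
    intervalIntegral.integral_const_mul, hzero, mul_zero, add_zero,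
    intervalIntegral.integral_of_le hR.le, intervalIntegral.integral_of_le hR.le,
    integral_Ioc_eq_integral_Ioo, integral_Ioc_eq_integral_Ioo] at hle
  rw [← ofReal_integral_eq_lintegral_ofReal (hcont h1).1 (.of_forall fun r ↦ by positivity),
    ← ofReal_integral_eq_lintegral_ofReal (hcont h2).1 (.of_forall fun r ↦ by positivity)]
  exact ENNReal.ofReal_le_ofReal hle

section Polar

variable {E : Type*} [NormedAddCommGroup E] [NormedSpace ℝ E] [Nontrivial E]
  [FiniteDimensional ℝ E] [MeasurableSpace E] [BorelSpace E]
  (μ : Measure E) [μ.IsAddHaarMeasure]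

/-- Integration in polar coordinates. -/
lemma lintegral_eq_lintegral_toSphere {f : E → ℝ≥0∞} (hf : Measurable f) :
    ∫⁻ y, f y ∂μ = ∫⁻ θ : sphere (0 : E) 1, (∫⁻ r in Set.Ioi (0 : ℝ),
      ENNReal.ofReal (r ^ (Module.finrank ℝ E - 1)) * f (r • (θ : E))) ∂μ.toSphere := by
  have hmp := μ.measurePreserving_homeomorphUnitSphereProd
  have hg : Measurable fun p : sphere (0 : E) 1 × Set.Ioi (0 : ℝ) ↦
      f ((p.2 : ℝ) • (p.1 : E)) := by fun_prop
  calc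
    ∫⁻ y, f y ∂μ = ∫⁻ y : ({(0)}ᶜ : Set E), f y ∂(μ.comap (↑)) := by
      rw [lintegral_subtype_comap (measurableSet_singleton _).compl, restrict_compl_singleton]
    _ = ∫⁻ p, f ((p.2 : ℝ) • (p.1 : E))
        ∂(μ.toSphere.prod (.volumeIoiPow (Module.finrank ℝ E - 1))) := by
      rw [← hmp.lintegral_comp hg]
      refine lintegral_congr fun y ↦ ?_
      have : ‖(y : E)‖ ≠ 0 := norm_ne_zero_iff.2 y.2
      simp [smul_smul, this]
    _ = _ := by
      rw [lintegral_prod _ hg.aemeasurable]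
      refine lintegral_congr fun θ ↦ ?_
      rw [Measure.volumeIoiPow, lintegral_withDensity_eq_lintegral_mul _ (by fun_prop)
        (by fun_prop), ← lintegral_subtype_comap measurableSet_Ioi]
      rfl

/-- Integration over a ball in polar coordinates. -/
lemma setLIntegral_ball_eq_lintegral_toSphere {R : ℝ} {f : E → ℝ≥0∞}
    (hf : Measurable ((ball 0 R).indicator f)) :
    ∫⁻ y in ball 0 R, f y ∂μ = ∫⁻ θ : sphere (0 : E) 1, (∫⁻ r in Set.Ioo (0 : ℝ) R,
      ENNReal.ofReal (r ^ (Module.finrank ℝ E - 1)) * f (r • (θ : E))) ∂μ.toSphere := by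
  rw [← lintegral_indicator measurableSet_ball, lintegral_eq_lintegral_toSphere μ hf]
  refine lintegral_congr fun θ ↦ ?_
  rw [← Set.Ioi_inter_Iio, Set.inter_comm, ← Measure.restrict_restrict measurableSet_Iio,
    ← lintegral_indicator measurableSet_Iio]
  refine setLIntegral_congr_fun measurableSet_Ioi fun r (hr : 0 < r) ↦ ?_
  by_cases h : r < R <;> simp [Set.indicator, norm_smul, abs_of_pos hr, h]

end Polar

/-- Hölder's inequality between `L²` and `L⁶` on a set of finite measure. -/
lemma integral_sq_le_integral_pow_six_rpow {α : Type*} [MeasurableSpace α] {μ : Measure α}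
    [IsFiniteMeasure μ] {w : α → ℝ} (hw : MemLp w ∞ μ) :
    ∫ y, w y ^ 2 ∂μ ≤ (∫ y, w y ^ 6 ∂μ) ^ ((1 : ℝ) / 3) * μ.real Set.univ ^ ((2 : ℝ) / 3) := by
  have hw2 : MemLp (fun y ↦ w y ^ 2) ∞ μ := by
    simp only [sq]
    exact hw.mul hw
  have h := integral_mul_le_Lp_mul_Lq_of_nonneg (μ := μ) (p := 3) (q := 3 / 2)
    (f := fun y ↦ w y ^ 2) (g := fun _ ↦ 1) ⟨by norm_num, by norm_num, by norm_num⟩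
    (.of_forall fun y ↦ by positivity) (.of_forall fun y ↦ by simp)
    (hw2.mono_exponent le_top) (memLp_const 1)
  have e (y : α) : (w y ^ 2) ^ (3 : ℝ) = w y ^ 6 := by
    rw [show (3 : ℝ) = (3 : ℕ) by norm_num, Real.rpow_natCast]
    ring
  simpa [e] using h

section Ball

variable {R : ℝ} {w : EuclideanSpace ℝ (Fin 3) → ℝ}

lemma norm_gradient_eq_norm_fderiv {F : Type*} [NormedAddCommGroup F] [InnerProductSpace ℝ F]
    [CompleteSpace F] (f : F → ℝ) (y : F) : ‖gradient f y‖ = ‖fderiv ℝ f y‖ := by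
  rw [← toDual_gradient, LinearIsometryEquiv.norm_map]

lemma lintegral_ball_sq_div_le (hR : 0 < R) (hw : ContDiffOn ℝ 1 w (closedBall 0 R)) :
    ∫⁻ y in ball 0 R, ENNReal.ofReal (w y ^ 2 / ‖y‖ ^ 2) ≤
      ∫⁻ y in ball 0 R, ENNReal.ofReal (6 / R ^ 2 * w y ^ 2 + 4 * ‖gradient w y‖ ^ 2) := by
  have hu : UniqueDiffOn ℝ (closedBall (0 : EuclideanSpace ℝ (Fin 3)) R) :=
    uniqueDiffOn_convex (convex_closedBall _ _)
      ⟨0, by rw [interior_closedBall _ hR.ne']; simpa⟩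
  have hD := hw.continuousOn_fderivWithin hu le_rfl
  have hnhds {y : EuclideanSpace ℝ (Fin 3)} (hy : y ∈ ball 0 R) : closedBall 0 R ∈ nhds y :=
    Filter.mem_of_superset (isOpen_ball.mem_nhds hy) ball_subset_closedBall
  have hwm : Measurable ((ball 0 R).indicator w) := by
    classical
    rw [← Set.piecewise_eq_indicator]
    exact (hw.continuousOn.mono ball_subset_closedBall).measurable_piecewise
      continuousOn_const measurableSet_ball
  have hgm : Measurable fun y ↦ ‖gradient w y‖ := by
    simp only [norm_gradient_eq_norm_fderiv]
    exact (measurable_fderiv ℝ w).norm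
  rw [setLIntegral_ball_eq_lintegral_toSphere, setLIntegral_ball_eq_lintegral_toSphere]
  · refine lintegral_mono fun θ ↦ ?_
    have hθ : ‖(θ : EuclideanSpace ℝ (Fin 3))‖ = 1 := by simp
    have hmaps : Set.MapsTo (fun r : ℝ ↦ r • (θ : EuclideanSpace ℝ (Fin 3)))
        (Set.Icc 0 R) (closedBall 0 R) := fun r hr ↦ by
      simpa [norm_smul, abs_of_nonneg hr.1] using hr.2
    have hball {r : ℝ} (hr : r ∈ Set.Ioo 0 R) :
        r • (θ : EuclideanSpace ℝ (Fin 3)) ∈ ball 0 R := by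
      simpa [norm_smul, abs_of_pos hr.1] using hr.2
    have key := lintegral_sq_le_of_hasDerivAt hR
      (f := fun r ↦ w (r • (θ : EuclideanSpace ℝ (Fin 3))))
      (f' := fun r ↦ fderivWithin ℝ w (closedBall 0 R) (r • (θ : EuclideanSpace ℝ (Fin 3))) θ)
      (hw.continuousOn.comp (by fun_prop) hmaps)
      ((hD.comp (by fun_prop) hmaps).clm_apply continuousOn_const)
      (fun r hr ↦ by
        have h1 : HasFDerivAt w (fderivWithin ℝ w (closedBall 0 R) (r • θ.1)) (r • θ.1) :=
          ((hw.differentiableOn one_ne_zero _ (ball_subset_closedBall (hball hr))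
            ).hasFDerivWithinAt).hasFDerivAt (hnhds (hball hr))
        have h2 : HasDerivAt (fun r : ℝ ↦ r • θ.1) θ.1 r := by
          simpa using (hasDerivAt_id r).smul_const θ.1
        exact h1.comp_hasDerivAt r h2)
    refine le_trans (le_of_eq ?_) (key.trans ?_)
    · refine setLIntegral_congr_fun measurableSet_Ioo fun r hr ↦ ?_
      have : 0 < r := hr.1
      rw [← ENNReal.ofReal_mul (by positivity)]
      congr 1
      simp only [norm_smul, hθ, finrank_euclideanSpace, Fintype.card_fin, Real.norm_eq_abs,
        mul_one, sq_abs, Nat.add_one_sub_one]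
      field_simp
    · refine setLIntegral_mono' measurableSet_Ioo fun r hr ↦ ?_
      rw [← ENNReal.ofReal_mul (by have := hr.1; positivity)]
      refine ENNReal.ofReal_le_ofReal ?_
      simp only [finrank_euclideanSpace, Fintype.card_fin, norm_gradient_eq_norm_fderiv]
      rw [← fderivWithin_of_mem_nhds (hnhds (hball hr)), ← sq_abs (fderivWithin ℝ w _ _ _)]
      gcongr
      simpa [hθ] using (fderivWithin ℝ w (closedBall 0 R) (r • θ.1)).le_opNorm θ.1
  · have : Measurable ((ball 0 R).indicator fun y ↦ ENNReal.ofReal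
      (6 / R ^ 2 * ((ball 0 R).indicator w y) ^ 2 + 4 * ‖gradient w y‖ ^ 2)) :=
      Measurable.indicator (by fun_prop) measurableSet_ball
    rw [Set.indicator_congr fun y hy ↦ by rw [Set.indicator_of_mem hy]] at this
    exact this
  · have : Measurable ((ball 0 R).indicator fun y ↦ ENNReal.ofReal
      (((ball 0 R).indicator w y) ^ 2 / ‖y‖ ^ 2)) :=
      Measurable.indicator (by fun_prop) measurableSet_ball
    rw [Set.indicator_congr fun y hy ↦ by rw [Set.indicator_of_mem hy]] at this
    exact this

lemma integrableOn_ball_norm_gradient_sq (hR : 0 < R)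
    (hw : ContDiffOn ℝ 1 w (closedBall 0 R)) :
    IntegrableOn (fun y ↦ ‖gradient w y‖ ^ 2) (ball 0 R) := by
  have hu : UniqueDiffOn ℝ (closedBall (0 : EuclideanSpace ℝ (Fin 3)) R) :=
    uniqueDiffOn_convex (convex_closedBall _ _)
      ⟨0, by rw [interior_closedBall _ hR.ne']; simpa⟩
  have h := ((hw.continuousOn_fderivWithin hu le_rfl).norm.pow 2).integrableOn_compact
    (μ := volume) (isCompact_closedBall _ _)
  refine (h.mono_set ball_subset_closedBall).congr_fun (fun y hy ↦ ?_) measurableSet_ball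
  simp only [Pi.pow_apply]
  rw [norm_gradient_eq_norm_fderiv, fderivWithin_of_mem_nhds
    (Filter.mem_of_superset (isOpen_ball.mem_nhds hy) ball_subset_closedBall)]

lemma memLp_top_ball_of_continuousOn (hw : ContinuousOn w (closedBall 0 R)) :
    MemLp w ∞ (volume.restrict (ball 0 R)) := by
  obtain ⟨M, hM⟩ := (isCompact_closedBall _ _).exists_bound_of_continuousOn hw
  refine memLp_top_of_bound
    ((hw.mono ball_subset_closedBall).aestronglyMeasurable measurableSet_ball) M ?_
  filter_upwards [ae_restrict_mem measurableSet_ball] with y hy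
  exact hM y (ball_subset_closedBall hy)

lemma volume_real_ball_rpow (hR : 0 < R) :
    volume.real (ball (0 : EuclideanSpace ℝ (Fin 3)) R) ^ ((2 : ℝ) / 3) =
      R ^ 2 * volume.real (ball (0 : EuclideanSpace ℝ (Fin 3)) 1) ^ ((2 : ℝ) / 3) := by
  rw [measureReal_def, Measure.addHaar_ball _ _ hR.le, ENNReal.toReal_mul,
    ENNReal.toReal_ofReal (by positivity), Real.mul_rpow (by positivity) (by positivity),
    measureReal_def, finrank_euclideanSpace, Fintype.card_fin, ← Real.rpow_natCast,
    ← Real.rpow_mul hR.le, ← Real.rpow_natCast]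
  norm_num

end Ball

/-- Local Hardy inequality on balls of `ℝ³`: there is a universal
constant `C > 0` such that for every `R > 0` and every `w` of class `C¹` on the closed
ball `B(0,R)`, `∫_{B(0,R)} w²/|y|² ≤ C (∫_{B(0,R)} |∇w|² + (∫_{B(0,R)} w⁶)^{1/3})`. -/
theorem local_hardy_inequality :
    ∃ C : ℝ, 0 < C ∧ ∀ R : ℝ, 0 < R → ∀ w : EuclideanSpace ℝ (Fin 3) → ℝ,
      ContDiffOn ℝ 1 w (Metric.closedBall 0 R) →
      ∫⁻ y in Metric.ball (0 : EuclideanSpace ℝ (Fin 3)) R,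
          ENNReal.ofReal ((w y) ^ 2 / ‖y‖ ^ 2)
        ≤ ENNReal.ofReal (C *
            ((∫ y in Metric.ball (0 : EuclideanSpace ℝ (Fin 3)) R, ‖gradient w y‖ ^ 2)
              + (∫ y in Metric.ball (0 : EuclideanSpace ℝ (Fin 3)) R, (w y) ^ 6)
                  ^ ((1:ℝ)/3))) := by
  set V := volume.real (ball (0 : EuclideanSpace ℝ (Fin 3)) 1) ^ ((2 : ℝ) / 3) with hV
  have hV0 : 0 ≤ V := by positivity
  refine ⟨6 * V + 4, by positivity, fun R hR w hw ↦ (lintegral_ball_sq_div_le hR hw).trans ?_⟩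
  have : IsFiniteMeasure (volume.restrict (ball (0 : EuclideanSpace ℝ (Fin 3)) R)) :=
    ⟨by simpa only [Measure.restrict_apply_univ] using measure_ball_lt_top⟩
  have hmem := memLp_top_ball_of_continuousOn hw.continuousOn
  have hw2 := ((hmem.mono_exponent (p := 2) le_top).integrable_sq).const_mul (6 / R ^ 2)
  have hg := (integrableOn_ball_norm_gradient_sq hR hw).const_mul 4
  rw [← ofReal_integral_eq_lintegral_ofReal (f := fun y ↦ 6 / R ^ 2 * w y ^ 2 +
    4 * ‖gradient w y‖ ^ 2) (hw2.add hg) (.of_forall fun y ↦ by positivity)]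
  refine ENNReal.ofReal_le_ofReal ?_
  rw [integral_add hw2 hg, integral_const_mul, integral_const_mul]
  have hH := integral_sq_le_integral_pow_six_rpow hmem
  rw [measureReal_restrict_apply_univ, volume_real_ball_rpow hR, ← hV] at hH
  have hG : 0 ≤ ∫ y in ball (0 : EuclideanSpace ℝ (Fin 3)) R, ‖gradient w y‖ ^ 2 :=
    integral_nonneg fun y ↦ by positivity
  have hI : 0 ≤ (∫ y in ball (0 : EuclideanSpace ℝ (Fin 3)) R, w y ^ 6) ^ ((1 : ℝ) / 3) :=
    Real.rpow_nonneg (integral_nonneg fun y ↦ by positivity) _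
  set G := ∫ y in ball (0 : EuclideanSpace ℝ (Fin 3)) R, ‖gradient w y‖ ^ 2
  set I := (∫ y in ball (0 : EuclideanSpace ℝ (Fin 3)) R, w y ^ 6) ^ ((1 : ℝ) / 3)
  have hmul : 6 / R ^ 2 * ∫ y in ball (0 : EuclideanSpace ℝ (Fin 3)) R, w y ^ 2 ≤
      6 * V * I := by
    calc _ ≤ 6 / R ^ 2 * (I * (R ^ 2 * V)) := by gcongr
      _ = 6 * V * I := by field_simp
  nlinarith [mul_nonneg hV0 hG]
end
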